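/- Let V₁, V₂, V₃ be complex vector spaces with sl₂-actions, v_i ∈ V_i primitive of weights m_i (nonnegative integers), and S_i contravariant symmetric bilinear forms with S_i(v_i,v_i) = 1; let S = S₁⊗S₂⊗S₃ on V₁⊗V₂⊗V₃. Let r be a nonnegative integer and r₁ an admissible index. Then S(W_{r₁}, W_{r₁}) = [C(m₁+m₂−r₁+1, r₁)/((m₁)_{r₁}(m₂)_{r₁})] · [C(m₁+m₂+m₃−r−r₁+1, r−r₁)/((m₁+m₂−2r₁)_{r−r₁}(m₃)_{r−r₁})], where C(n,k) is the binomial coefficient. -/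

import Mathlib

open scoped TensorProduct

/-- An sl₂-action on a complex vector space `V`. -/
def IsSl2Action {V : Type*} [AddCommGroup V] [Module ℂ V]
    (e f h : Module.End ℂ V) : Prop :=
  h ∘ₗ e - e ∘ₗ h = (2 : ℂ) • e ∧ h ∘ₗ f - f ∘ₗ h = (-2 : ℂ) • f ∧ e ∘ₗ f - f ∘ₗ e = h

/-- The falling factorial `(x)_n = x(x−1)⋯(x−n+1)`, with `(x)_0 = 1`. -/
noncomputable def fallFac (x : ℂ) (n : ℕ) : ℂ := ∏ i ∈ Finset.range n, (x - i)

/-- `r₁` is admissible for `(m₁, m₂, m₃, r)` when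
`max(0, r−m₃) ≤ r₁ ≤ min(r, min(m₁,m₂), m₁+m₂−r)`. -/
def Admissible (m₁ m₂ m₃ r : ℕ) (k : ℤ) : Prop :=
  (r : ℤ) - (m₃ : ℤ) ≤ k ∧ 0 ≤ k ∧ k ≤ (r : ℤ) ∧ k ≤ (m₁ : ℤ) ∧ k ≤ (m₂ : ℤ) ∧
    k ≤ (m₁ : ℤ) + (m₂ : ℤ) - (r : ℤ)

/-- The coefficient `C^{r₁}_{i,j}` from the Shapovalov basis formula. -/
noncomputable def Ccoef (m₁ m₂ m₃ r r₁ i j : ℕ) : ℂ :=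
  (1 / (fallFac (m₁ : ℂ) i * fallFac (m₂ : ℂ) (r₁ - i) *
      (Nat.factorial i : ℂ) * (Nat.factorial (r₁ - i) : ℂ))) *
  (1 / (fallFac ((m₁ : ℂ) + (m₂ : ℂ) - 2 * (r₁ : ℂ)) j * fallFac (m₃ : ℂ) (r - r₁ - j) *
      (Nat.factorial j : ℂ) * (Nat.factorial (r - r₁ - j) : ℂ)))

/-- The (unnormalized) Shapovalov basis vector
`W_{r₁} = Σᵢⱼ (−1)^{i+j} C^{r₁}_{i,j} · f^j(fⁱv₁ ⊗ f^{r₁−i}v₂) ⊗ f^{r−r₁−j}v₃`,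
where `f` acts diagonally on the first two tensor factors. -/
noncomputable def Wvec {V₁ V₂ V₃ : Type*} [AddCommGroup V₁] [Module ℂ V₁]
    [AddCommGroup V₂] [Module ℂ V₂] [AddCommGroup V₃] [Module ℂ V₃]
    (f₁ : Module.End ℂ V₁) (f₂ : Module.End ℂ V₂) (f₃ : Module.End ℂ V₃)
    (v₁ : V₁) (v₂ : V₂) (v₃ : V₃) (m₁ m₂ m₃ r r₁ : ℕ) : (V₁ ⊗[ℂ] V₂) ⊗[ℂ] V₃ :=
  ∑ i ∈ Finset.range (r₁ + 1), ∑ j ∈ Finset.range (r - r₁ + 1),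
    ((-1 : ℂ) ^ (i + j) * Ccoef m₁ m₂ m₃ r r₁ i j) •
      ((((LinearMap.rTensor V₂ f₁ + LinearMap.lTensor V₁ f₂ :
            Module.End ℂ (V₁ ⊗[ℂ] V₂)) ^ j)
          (((f₁ ^ i) v₁) ⊗ₜ[ℂ] ((f₂ ^ (r₁ - i)) v₂))) ⊗ₜ[ℂ] ((f₃ ^ (r - r₁ - j)) v₃))

namespace IsSl2Action

variable {V : Type*} [AddCommGroup V] [Module ℂ V] {e f h : Module.End ℂ V}

theorem h_pow_apply (hsl : IsSl2Action e f h) {a : ℂ} {v : V} (hv : h v = a • v) (n : ℕ) :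
    h ((f ^ n) v) = (a - 2 * n) • (f ^ n) v := by
  induction n with
  | zero => simp [hv]
  | succ n ih =>
    have key := LinearMap.congr_fun hsl.2.1 ((f ^ n) v)
    simp only [LinearMap.sub_apply, LinearMap.comp_apply, LinearMap.smul_apply, ih, map_smul] at key
    rw [pow_succ', Module.End.mul_apply, eq_add_of_sub_eq key]
    push_cast
    module

theorem e_pow_succ_apply (hsl : IsSl2Action e f h) {a : ℂ} {v : V} (hve : e v = 0)
    (hv : h v = a • v) (n : ℕ) :
    e ((f ^ (n + 1)) v) = ((n + 1) * (a - n)) • (f ^ n) v := by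
  induction n with
  | zero =>
    have key := LinearMap.congr_fun hsl.2.2 v
    simp only [LinearMap.sub_apply, LinearMap.comp_apply, hve, map_zero, sub_zero, hv] at key
    simp [key]
  | succ n ih =>
    have key := LinearMap.congr_fun hsl.2.2 ((f ^ (n + 1)) v)
    simp only [LinearMap.sub_apply, LinearMap.comp_apply, ih, map_smul,
      hsl.h_pow_apply hv] at key
    rw [pow_succ' f (n + 1), Module.End.mul_apply, eq_add_of_sub_eq key,
      ← Module.End.mul_apply f, ← pow_succ']
    push_cast
    module

end IsSl2Action

theorem fallFac_succ (x : ℂ) (n : ℕ) : fallFac x (n + 1) = fallFac x n * (x - n) :=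
  Finset.prod_range_succ _ _

theorem fallFac_natCast (m n : ℕ) : fallFac m n = m.descFactorial n := by
  induction n with
  | zero => simp [fallFac]
  | succ n ih =>
    rw [fallFac_succ, ih, Nat.descFactorial_succ]
    rcases le_or_gt n m with hnm | hnm
    · push_cast [Nat.cast_sub hnm]
      ring
    · simp [Nat.descFactorial_of_lt hnm]

theorem fallFac_natCast_ne_zero {m n : ℕ} (hnm : n ≤ m) : fallFac m n ≠ 0 := by
  rw [fallFac_natCast, Nat.cast_ne_zero]
  exact (Nat.descFactorial_pos.mpr hnm).ne'

/-- A contravariant form is diagonal on the descendants of a primitive vector. -/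
theorem contravariant_pow_apply {V : Type*} [AddCommGroup V] [Module ℂ V]
    {e f h : Module.End ℂ V} (hsl : IsSl2Action e f h) {a : ℂ} {v : V} (hve : e v = 0)
    (hv : h v = a • v) {S : V →ₗ[ℂ] V →ₗ[ℂ] ℂ} (hsymm : ∀ x y, S x y = S y x)
    (hcontra : ∀ x y, S (e x) y = S x (f y)) (i j : ℕ) :
    S ((f ^ i) v) ((f ^ j) v) =
      if i = j then (i.factorial : ℂ) * fallFac a i * S v v else 0 := by
  have hlower (x y : V) : S (f x) y = S x (e y) := by rw [hsymm, ← hcontra, hsymm]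
  induction i generalizing j with
  | zero =>
    cases j with
    | zero => simp [fallFac]
    | succ j =>
      rw [pow_succ', Module.End.mul_apply, ← hcontra]
      simp [hve]
  | succ i ih =>
    rw [pow_succ' f i, Module.End.mul_apply, hlower]
    cases j with
    | zero => simp [hve]
    | succ j =>
      rw [hsl.e_pow_succ_apply hve hv, map_smul, ih]
      by_cases hij : i = j
      · subst hij
        simp only [if_true, smul_eq_mul, Nat.factorial_succ, fallFac_succ]
        push_cast
        ring
      · simp [hij]

theorem sum_antidiagonal_choose_mul_choose (p q n : ℕ) :
    ∑ ij ∈ Finset.HasAntidiagonal.antidiagonal n, (p + ij.1).choose p * (q + ij.2).choose q =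
      (p + q + 1 + n).choose n := by
  have key : (PowerSeries.mk 1 : PowerSeries ℤ) ^ (p + 1) * PowerSeries.mk 1 ^ (q + 1) =
      PowerSeries.mk 1 ^ (p + q + 1 + 1) := by
    rw [← pow_add]
    congr 1
    ring
  simp only [PowerSeries.mk_one_pow_eq_mk_choose_add] at key
  have hcoeff := congrArg (PowerSeries.coeff n) key
  simp only [PowerSeries.coeff_mul, PowerSeries.coeff_mk] at hcoeff
  rw [Nat.choose_symm_add] at hcoeff
  exact_mod_cast hcoeff

/-- The coefficient of `f ^ i u ⊗ f ^ (n - i) v` in the two-factor singular vector, up to sign. -/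
noncomputable def singularCoef (a b : ℂ) (n i : ℕ) : ℂ :=
  1 / (fallFac a i * fallFac b (n - i) * (i.factorial : ℂ) * ((n - i).factorial : ℂ))

theorem singularCoef_eq_choose {a b n i : ℕ} (ha : n ≤ a) (hb : n ≤ b) (hi : i ≤ n) :
    singularCoef a b n i =
      ((a - n + (n - i)).choose (a - n) * (b - n + i).choose (b - n) : ℕ) /
        (fallFac a n * fallFac b n) := by
  obtain ⟨k, rfl⟩ := Nat.exists_eq_add_of_le hi
  obtain ⟨p, rfl⟩ := Nat.exists_eq_add_of_le ha
  obtain ⟨q, rfl⟩ := Nat.exists_eq_add_of_le hb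
  have split (c i k : ℕ) : (i + k + c).descFactorial (i + k) =
      (i + k + c).descFactorial i * (k.factorial * (c + k).choose c) := by
    rw [← Nat.descFactorial_mul_descFactorial (Nat.le_add_right i k),
      Nat.choose_symm_add, ← Nat.descFactorial_eq_factorial_mul_choose, mul_comm]
    congr 2 <;> omega
  have h₁ := split p i k
  have h₂ := split q k i
  rw [add_comm k i] at h₂
  have n₁ := fallFac_natCast_ne_zero (m := i + k + p) (n := i) (by omega)
  have n₂ := fallFac_natCast_ne_zero (m := i + k + q) (n := k) (by omega)
  have n₃ : ((p + k).choose p : ℂ) ≠ 0 :=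
    Nat.cast_ne_zero.mpr (Nat.choose_pos (Nat.le_add_right p k)).ne'
  have n₄ : ((q + i).choose q : ℂ) ≠ 0 :=
    Nat.cast_ne_zero.mpr (Nat.choose_pos (Nat.le_add_right q i)).ne'
  have n₅ : (i.factorial : ℂ) ≠ 0 := Nat.cast_ne_zero.mpr i.factorial_ne_zero
  have n₆ : (k.factorial : ℂ) ≠ 0 := Nat.cast_ne_zero.mpr k.factorial_ne_zero
  have hp : i + k + p - (i + k) = p := by omega
  have hq : i + k + q - (i + k) = q := by omega
  have hk : i + k - i = k := by omega
  rw [fallFac_natCast] at n₁ n₂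
  simp only [singularCoef, hp, hq, hk, fallFac_natCast, h₁, h₂]
  push_cast
  field_simp

theorem sum_singularCoef {a b n : ℕ} (ha : n ≤ a) (hb : n ≤ b) :
    ∑ i ∈ Finset.range (n + 1), singularCoef a b n i =
      ((a + b + 1 - n).choose n : ℂ) / (fallFac a n * fallFac b n) := by
  rw [Finset.sum_congr rfl fun i hi =>
      singularCoef_eq_choose ha hb (Nat.lt_succ_iff.mp (Finset.mem_range.mp hi)),
    ← Finset.sum_div, ← Nat.cast_sum]
  congr 2
  have key := sum_antidiagonal_choose_mul_choose (b - n) (a - n) n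
  rw [Finset.Nat.sum_antidiagonal_eq_sum_range_succ_mk] at key
  simp only [mul_comm] at key ⊢
  rw [key]
  congr 1
  omega

section TwoFactors

variable {U V : Type*} [AddCommGroup U] [Module ℂ U] [AddCommGroup V] [Module ℂ V]

/-- The diagonal action of a Lie algebra element on a tensor product. -/
noncomputable abbrev diagonalAction (x : Module.End ℂ U) (y : Module.End ℂ V) :
    Module.End ℂ (U ⊗[ℂ] V) :=
  LinearMap.rTensor V x + LinearMap.lTensor U y

theorem diagonalAction_commutator (x x' : Module.End ℂ U) (y y' : Module.End ℂ V) :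
    diagonalAction x y ∘ₗ diagonalAction x' y' - diagonalAction x' y' ∘ₗ diagonalAction x y =
      diagonalAction (x ∘ₗ x' - x' ∘ₗ x) (y ∘ₗ y' - y' ∘ₗ y) := by
  refine TensorProduct.ext' fun s t => ?_
  simp only [LinearMap.sub_apply, LinearMap.comp_apply, LinearMap.add_apply,
    LinearMap.rTensor_tmul, LinearMap.lTensor_tmul, map_add,
    TensorProduct.sub_tmul, TensorProduct.tmul_sub]
  abel

theorem IsSl2Action.diagonalAction {e f h : Module.End ℂ U} {e' f' h' : Module.End ℂ V}
    (hU : IsSl2Action e f h) (hV : IsSl2Action e' f' h') :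
    IsSl2Action (diagonalAction e e') (diagonalAction f f') (diagonalAction h h') := by
  obtain ⟨hU₁, hU₂, hU₃⟩ := hU
  obtain ⟨hV₁, hV₂, hV₃⟩ := hV
  refine ⟨?_, ?_, ?_⟩ <;> rw [diagonalAction_commutator]
  · rw [hU₁, hV₁]
    simp only [_root_.diagonalAction, LinearMap.rTensor_smul, LinearMap.lTensor_smul, smul_add]
  · rw [hU₂, hV₂]
    simp only [_root_.diagonalAction, LinearMap.rTensor_smul, LinearMap.lTensor_smul, smul_add]
  · rw [hU₃, hV₃]

/-- The vector of weight `a + b - 2n` in `U ⊗ V` built from vectors of weights `a` and `b`. -/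
noncomputable def singularVec (f : Module.End ℂ U) (f' : Module.End ℂ V) (u : U) (v : V)
    (a b : ℂ) (n : ℕ) : U ⊗[ℂ] V :=
  ∑ i ∈ Finset.range (n + 1),
    ((-1 : ℂ) ^ i * singularCoef a b n i) • (((f ^ i) u) ⊗ₜ[ℂ] ((f' ^ (n - i)) v))

variable {e f h : Module.End ℂ U} {e' f' h' : Module.End ℂ V} {u : U} {v : V}

theorem diagonalAction_e_singularVec (hU : IsSl2Action e f h) (hV : IsSl2Action e' f' h')
    {a b n : ℕ} (ha : n ≤ a) (hb : n ≤ b)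
    (hue : e u = 0) (huh : h u = (a : ℂ) • u) (hve : e' v = 0) (hvh : h' v = (b : ℂ) • v) :
    diagonalAction e e' (singularVec f f' u v a b n) = 0 := by
  cases n with
  | zero => simp [singularVec, hue, hve]
  | succ n =>
    simp only [singularVec, LinearMap.add_apply, map_sum, map_smul, LinearMap.rTensor_tmul,
      LinearMap.lTensor_tmul, smul_add, Finset.sum_add_distrib]
    rw [Finset.sum_range_succ', Finset.sum_range_succ _ (n + 1)]
    simp only [pow_zero, Module.End.one_apply, hue, hve, TensorProduct.zero_tmul,
      TensorProduct.tmul_zero, smul_zero, add_zero, Nat.sub_self]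
    rw [← Finset.sum_add_distrib]
    refine Finset.sum_eq_zero fun i hi => ?_
    obtain ⟨k, rfl⟩ := Nat.exists_eq_add_of_le (Nat.lt_succ_iff.mp (Finset.mem_range.mp hi))
    have hk : i + k + 1 - (i + 1) = k := by omega
    have hk' : i + k + 1 - i = k + 1 := by omega
    rw [hk, hk', hU.e_pow_succ_apply hue huh, hV.e_pow_succ_apply hve hvh,
      TensorProduct.tmul_smul, ← TensorProduct.smul_tmul', smul_smul, smul_smul, ← add_smul]
    convert zero_smul ℂ _ using 2
    have n₁ : (a : ℂ) - i ≠ 0 := sub_ne_zero.mpr (Nat.cast_injective.ne (by omega))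
    have n₂ : (b : ℂ) - k ≠ 0 := sub_ne_zero.mpr (Nat.cast_injective.ne (by omega))
    have n₃ := fallFac_natCast_ne_zero (m := a) (n := i) (by omega)
    have n₄ := fallFac_natCast_ne_zero (m := b) (n := k) (by omega)
    have n₅ : (i.factorial : ℂ) ≠ 0 := Nat.cast_ne_zero.mpr i.factorial_ne_zero
    have n₆ : (k.factorial : ℂ) ≠ 0 := Nat.cast_ne_zero.mpr k.factorial_ne_zero
    have n₇ : (i : ℂ) + 1 ≠ 0 := Nat.cast_add_one_ne_zero i
    have n₈ : (k : ℂ) + 1 ≠ 0 := Nat.cast_add_one_ne_zero k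
    simp only [singularCoef, hk, hk', fallFac_succ, Nat.factorial_succ]
    push_cast
    field_simp
    ring

theorem diagonalAction_h_singularVec (hU : IsSl2Action e f h) (hV : IsSl2Action e' f' h')
    {a b : ℂ} (n : ℕ) (huh : h u = a • u) (hvh : h' v = b • v) :
    diagonalAction h h' (singularVec f f' u v a b n) =
      (a + b - 2 * n) • singularVec f f' u v a b n := by
  simp only [singularVec, map_sum, Finset.smul_sum]
  refine Finset.sum_congr rfl fun i hi => ?_
  obtain ⟨k, rfl⟩ := Nat.exists_eq_add_of_le (Nat.lt_succ_iff.mp (Finset.mem_range.mp hi))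
  rw [map_smul, LinearMap.add_apply, LinearMap.rTensor_tmul, LinearMap.lTensor_tmul,
    hU.h_pow_apply huh, hV.h_pow_apply hvh, TensorProduct.tmul_smul,
    ← TensorProduct.smul_tmul', Nat.add_sub_cancel_left]
  push_cast
  module

theorem singularVec_norm (hU : IsSl2Action e f h) (hV : IsSl2Action e' f' h')
    {a b n : ℕ} (ha : n ≤ a) (hb : n ≤ b)
    (hue : e u = 0) (huh : h u = (a : ℂ) • u) (hve : e' v = 0) (hvh : h' v = (b : ℂ) • v)
    {S : U →ₗ[ℂ] U →ₗ[ℂ] ℂ} {S' : V →ₗ[ℂ] V →ₗ[ℂ] ℂ}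
    (hsymm : ∀ x y, S x y = S y x) (hsymm' : ∀ x y, S' x y = S' y x)
    (hcontra : ∀ x y, S (e x) y = S x (f y)) (hcontra' : ∀ x y, S' (e' x) y = S' x (f' y))
    {T : (U ⊗[ℂ] V) →ₗ[ℂ] (U ⊗[ℂ] V) →ₗ[ℂ] ℂ}
    (hT : ∀ x x' y y', T (x ⊗ₜ y) (x' ⊗ₜ y') = S x x' * S' y y') :
    T (singularVec f f' u v a b n) (singularVec f f' u v a b n) =
      S u u * S' v v * (((a + b + 1 - n).choose n : ℂ) / (fallFac a n * fallFac b n)) := by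
  rw [← sum_singularCoef ha hb, Finset.mul_sum]
  simp only [singularVec, map_sum, LinearMap.sum_apply, map_smul, LinearMap.smul_apply, hT,
    contravariant_pow_apply hU hue huh hsymm hcontra]
  refine Finset.sum_congr rfl fun i hi => ?_
  rw [Finset.sum_eq_single_of_mem i hi fun j _ hji => by simp [hji]]
  obtain ⟨k, rfl⟩ := Nat.exists_eq_add_of_le (Nat.lt_succ_iff.mp (Finset.mem_range.mp hi))
  have n₃ := fallFac_natCast_ne_zero (m := a) (n := i) (by omega)
  have n₄ := fallFac_natCast_ne_zero (m := b) (n := k) (by omega)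
  have n₅ : (i.factorial : ℂ) ≠ 0 := Nat.cast_ne_zero.mpr i.factorial_ne_zero
  have n₆ : (k.factorial : ℂ) ≠ 0 := Nat.cast_ne_zero.mpr k.factorial_ne_zero
  have hsign : ((-1 : ℂ) ^ i) ^ 2 = 1 := by rw [← pow_mul, mul_comm, pow_mul]; simp
  rw [contravariant_pow_apply hV hve hvh hsymm' hcontra']
  simp only [if_true, smul_eq_mul, singularCoef, Nat.add_sub_cancel_left]
  field_simp
  rw [hsign, one_mul]

theorem symm_of_apply_tmul {S : U →ₗ[ℂ] U →ₗ[ℂ] ℂ} {S' : V →ₗ[ℂ] V →ₗ[ℂ] ℂ}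
    (hsymm : ∀ x y, S x y = S y x) (hsymm' : ∀ x y, S' x y = S' y x)
    {T : (U ⊗[ℂ] V) →ₗ[ℂ] (U ⊗[ℂ] V) →ₗ[ℂ] ℂ}
    (hT : ∀ x x' y y', T (x ⊗ₜ y) (x' ⊗ₜ y') = S x x' * S' y y') (s t : U ⊗[ℂ] V) :
    T s t = T t s := by
  have key : T = T.flip := by
    ext x y x' y'
    simp [hT, hsymm x x', hsymm' y y']
  exact LinearMap.congr_fun₂ key s t

theorem contravariant_diagonalAction {S : U →ₗ[ℂ] U →ₗ[ℂ] ℂ} {S' : V →ₗ[ℂ] V →ₗ[ℂ] ℂ}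
    (hcontra : ∀ x y, S (e x) y = S x (f y)) (hcontra' : ∀ x y, S' (e' x) y = S' x (f' y))
    {T : (U ⊗[ℂ] V) →ₗ[ℂ] (U ⊗[ℂ] V) →ₗ[ℂ] ℂ}
    (hT : ∀ x x' y y', T (x ⊗ₜ y) (x' ⊗ₜ y') = S x x' * S' y y') (s t : U ⊗[ℂ] V) :
    T (diagonalAction e e' s) t = T s (diagonalAction f f' t) := by
  have key : T ∘ₗ diagonalAction e e' = T.compl₂ (diagonalAction f f') := by
    ext x y x' y'
    simp [hT, hcontra, hcontra']
  exact LinearMap.congr_fun₂ key s t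

end TwoFactors

theorem Wvec_eq_singularVec {V₁ V₂ V₃ : Type*} [AddCommGroup V₁] [Module ℂ V₁]
    [AddCommGroup V₂] [Module ℂ V₂] [AddCommGroup V₃] [Module ℂ V₃]
    (f₁ : Module.End ℂ V₁) (f₂ : Module.End ℂ V₂) (f₃ : Module.End ℂ V₃)
    (v₁ : V₁) (v₂ : V₂) (v₃ : V₃) (m₁ m₂ m₃ r r₁ : ℕ) :
    Wvec f₁ f₂ f₃ v₁ v₂ v₃ m₁ m₂ m₃ r r₁ =
      singularVec (diagonalAction f₁ f₂) f₃ (singularVec f₁ f₂ v₁ v₂ m₁ m₂ r₁) v₃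
        ((m₁ : ℂ) + m₂ - 2 * r₁) m₃ (r - r₁) := by
  rw [Wvec, Finset.sum_comm]
  refine Finset.sum_congr rfl fun j _ => ?_
  rw [singularVec, map_sum, TensorProduct.sum_tmul, Finset.smul_sum]
  refine Finset.sum_congr rfl fun i _ => ?_
  rw [map_smul, ← TensorProduct.smul_tmul', smul_smul]
  congr 1
  simp only [Ccoef, singularCoef]
  ring

/-- The Shapovalov norm of the basis vector `W_{r₁}`. -/
theorem Wvec_shapovalov_norm
    {V₁ V₂ V₃ : Type*} [AddCommGroup V₁] [Module ℂ V₁]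
    [AddCommGroup V₂] [Module ℂ V₂] [AddCommGroup V₃] [Module ℂ V₃]
    (e₁ f₁ h₁ : Module.End ℂ V₁) (e₂ f₂ h₂ : Module.End ℂ V₂) (e₃ f₃ h₃ : Module.End ℂ V₃)
    (hsl1 : IsSl2Action e₁ f₁ h₁) (hsl2 : IsSl2Action e₂ f₂ h₂) (hsl3 : IsSl2Action e₃ f₃ h₃)
    (m₁ m₂ m₃ : ℕ) (v₁ : V₁) (v₂ : V₂) (v₃ : V₃)
    (hv₁e : e₁ v₁ = 0) (hv₁h : h₁ v₁ = (m₁ : ℂ) • v₁)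
    (hv₂e : e₂ v₂ = 0) (hv₂h : h₂ v₂ = (m₂ : ℂ) • v₂)
    (hv₃e : e₃ v₃ = 0) (hv₃h : h₃ v₃ = (m₃ : ℂ) • v₃)
    (S₁ : V₁ →ₗ[ℂ] V₁ →ₗ[ℂ] ℂ) (S₂ : V₂ →ₗ[ℂ] V₂ →ₗ[ℂ] ℂ) (S₃ : V₃ →ₗ[ℂ] V₃ →ₗ[ℂ] ℂ)
    (hsymm₁ : ∀ x y : V₁, S₁ x y = S₁ y x) (hsymm₂ : ∀ x y : V₂, S₂ x y = S₂ y x)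
    (hsymm₃ : ∀ x y : V₃, S₃ x y = S₃ y x)
    (hcontra₁ : ∀ x y : V₁, S₁ (e₁ x) y = S₁ x (f₁ y))
    (hcontra₂ : ∀ x y : V₂, S₂ (e₂ x) y = S₂ x (f₂ y))
    (hcontra₃ : ∀ x y : V₃, S₃ (e₃ x) y = S₃ x (f₃ y))
    (hS₁v : S₁ v₁ v₁ = 1) (hS₂v : S₂ v₂ v₂ = 1) (hS₃v : S₃ v₃ v₃ = 1)
    (S : ((V₁ ⊗[ℂ] V₂) ⊗[ℂ] V₃) →ₗ[ℂ] ((V₁ ⊗[ℂ] V₂) ⊗[ℂ] V₃) →ₗ[ℂ] ℂ)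
    (hS : ∀ (a a' : V₁) (b b' : V₂) (c c' : V₃),
      S ((a ⊗ₜ[ℂ] b) ⊗ₜ[ℂ] c) ((a' ⊗ₜ[ℂ] b') ⊗ₜ[ℂ] c') = S₁ a a' * S₂ b b' * S₃ c c')
    (r r₁ : ℕ) (hadm : Admissible m₁ m₂ m₃ r (r₁ : ℤ)) :
    S (Wvec f₁ f₂ f₃ v₁ v₂ v₃ m₁ m₂ m₃ r r₁) (Wvec f₁ f₂ f₃ v₁ v₂ v₃ m₁ m₂ m₃ r r₁) =
      ((Nat.choose (m₁ + m₂ + 1 - r₁) r₁ : ℂ) /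
          (fallFac (m₁ : ℂ) r₁ * fallFac (m₂ : ℂ) r₁)) *
      ((Nat.choose (m₁ + m₂ + m₃ + 1 - r - r₁) (r - r₁) : ℂ) /
          (fallFac ((m₁ : ℂ) + (m₂ : ℂ) - 2 * (r₁ : ℂ)) (r - r₁) *
            fallFac (m₃ : ℂ) (r - r₁))) := by
  obtain ⟨hr₃, -, hr, hr₁, hr₂, hr₁₂⟩ := hadm
  obtain ⟨n, rfl⟩ : ∃ n, r = r₁ + n := Nat.exists_eq_add_of_le (by omega)
  obtain ⟨M, hM⟩ : ∃ M, m₁ + m₂ = 2 * r₁ + M := Nat.exists_eq_add_of_le (by omega)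
  have hMcast : (m₁ : ℂ) + m₂ - 2 * r₁ = M := by
    rw [← Nat.cast_add, hM]
    push_cast
    ring
  set w := singularVec f₁ f₂ v₁ v₂ m₁ m₂ r₁ with hw
  let T : (V₁ ⊗[ℂ] V₂) →ₗ[ℂ] (V₁ ⊗[ℂ] V₂) →ₗ[ℂ] ℂ :=
    S.compl₁₂ ((TensorProduct.mk ℂ (V₁ ⊗[ℂ] V₂) V₃).flip v₃)
      ((TensorProduct.mk ℂ (V₁ ⊗[ℂ] V₂) V₃).flip v₃)
  have hT (x x' : V₁) (y y' : V₂) : T (x ⊗ₜ y) (x' ⊗ₜ y') = S₁ x x' * S₂ y y' := by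
    simp [T, hS, hS₃v]
  have hST (x x' : V₁ ⊗[ℂ] V₂) (c c' : V₃) : S (x ⊗ₜ c) (x' ⊗ₜ c') = T x x' * S₃ c c' := by
    have key : S.compl₁₂ ((TensorProduct.mk ℂ (V₁ ⊗[ℂ] V₂) V₃).flip c)
        ((TensorProduct.mk ℂ (V₁ ⊗[ℂ] V₂) V₃).flip c') = S₃ c c' • T := by
      ext x y x' y'
      simp [hS, hT, mul_comm]
    simpa [mul_comm] using LinearMap.congr_fun₂ key x x'
  have hwe : diagonalAction e₁ e₂ w = 0 :=
    diagonalAction_e_singularVec hsl1 hsl2 (by omega) (by omega) hv₁e hv₁h hv₂e hv₂h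
  have hwh : diagonalAction h₁ h₂ w = (M : ℂ) • w := by
    rw [← hMcast]
    exact diagonalAction_h_singularVec hsl1 hsl2 r₁ hv₁h hv₂h
  rw [Wvec_eq_singularVec, hMcast, Nat.add_sub_cancel_left,
    singularVec_norm (hsl1.diagonalAction hsl2) hsl3 (by omega) (by omega) hwe hwh hv₃e hv₃h
      (symm_of_apply_tmul hsymm₁ hsymm₂ hT) hsymm₃
      (contravariant_diagonalAction hcontra₁ hcontra₂ hT) hcontra₃ hST,
    hw, singularVec_norm hsl1 hsl2 (by omega) (by omega) hv₁e hv₁h hv₂e hv₂h hsymm₁ hsymm₂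
      hcontra₁ hcontra₂ hT, hS₁v, hS₂v, hS₃v,
    show M + m₃ + 1 - n = m₁ + m₂ + m₃ + 1 - (r₁ + n) - r₁ by omega]
  ring
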